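/- arXiv:2307.00289 — 3 statements merged into one kernel-verified Lean document; each statement's English description precedes it below -/
import Mathlib

section
/- Let 𝔑₀₂ be the 4-dimensional complex Leibniz algebra with basis e₁,e₂,e₃,e₄ and nonzero products of basis vectors e₁e₁ = e₃, e₂e₂ = e₄. Then H²(𝔑₀₂,ℂ) has dimension 4, with basis given by the classes [Δ₁₂], [Δ₂₁], [Δ₃₁], [Δ₄₂]. -/
noncomputable section

/-- The bilinear multiplication on `ℂⁿ` determined by structure constants `c`,
with `eᵢ eⱼ = ∑ₖ c i j k • eₖ`. -/
def mulOf {n : ℕ} (c : Fin n → Fin n → Fin n → ℂ) (x y : Fin n → ℂ) : Fin n → ℂ :=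
  fun k => ∑ i, ∑ j, x i * y j * c i j k

/-- The bilinear form on `ℂⁿ` determined by the matrix `M`, with `θ(eᵢ,eⱼ) = M i j`. -/
def formOf {n : ℕ} (M : Matrix (Fin n) (Fin n) ℂ) (x y : Fin n → ℂ) : ℂ :=
  ∑ i, ∑ j, x i * M i j * y j

/-- `M` represents a cocycle: `θ(xy,z) = θ(xz,y) + θ(x,yz)` for all `x,y,z`. -/
def IsCocycle {n : ℕ} (c : Fin n → Fin n → Fin n → ℂ) (M : Matrix (Fin n) (Fin n) ℂ) : Prop :=
  ∀ x y z : Fin n → ℂ,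
    formOf M (mulOf c x y) z = formOf M (mulOf c x z) y + formOf M x (mulOf c y z)

/-- The bilinear form `Δ_{ij}` with `Δ_{ij}(e_l,e_m) = δ_{il} δ_{jm}` (as a matrix). -/
def Δ {n : ℕ} (i j : Fin n) : Matrix (Fin n) (Fin n) ℂ :=
  fun l m => if l = i ∧ m = j then 1 else 0

/-- `H²` of the algebra with structure constants `c` has dimension `d`, and the classes of
the cocycles `M 0, …, M (d-1)` form a basis: each `M i` is a cocycle, and every cocycle `N`
is, for a unique coefficient vector `a`, the sum of `∑ i, a i • M i` and a coboundary
`(x,y) ↦ f(xy)` (where `f` is the linear functional with coefficients `g`). -/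
def HBasis {n d : ℕ} (c : Fin n → Fin n → Fin n → ℂ)
    (M : Fin d → Matrix (Fin n) (Fin n) ℂ) : Prop :=
  (∀ i, IsCocycle c (M i)) ∧
  (∀ N : Matrix (Fin n) (Fin n) ℂ, IsCocycle c N →
    ∃! a : Fin d → ℂ, ∃ g : Fin n → ℂ, ∀ x y : Fin n → ℂ,
      formOf N x y = (∑ i, a i * formOf (M i) x y) + ∑ l, mulOf c x y l * g l)

/-- Every cocycle differs by a coboundary from a cocycle additionally satisfying the
"symmetric" identity `θ(x,yz) = θ(xy,z) + θ(y,xz)`, i.e. `H² = H²_𝒮`. -/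
def SymmReduce {n : ℕ} (c : Fin n → Fin n → Fin n → ℂ) : Prop :=
  ∀ N : Matrix (Fin n) (Fin n) ℂ, IsCocycle c N →
    ∃ (N' : Matrix (Fin n) (Fin n) ℂ) (g : Fin n → ℂ),
      IsCocycle c N' ∧
      (∀ x y z : Fin n → ℂ,
        formOf N' x (mulOf c y z) = formOf N' (mulOf c x y) z + formOf N' y (mulOf c x z)) ∧
      (∀ x y : Fin n → ℂ, formOf N x y = formOf N' x y + ∑ l, mulOf c x y l * g l)


/-- The 4-dimensional Leibniz algebra `𝔑₀₂`: `e₁e₁ = e₃`, `e₂e₂ = e₄`. -/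
def cM02 : Fin 4 → Fin 4 → Fin 4 → ℂ := fun i j k =>
  (if i = 0 ∧ j = 0 ∧ k = 2 then 1 else 0) +
  (if i = 1 ∧ j = 1 ∧ k = 3 then 1 else 0)

theorem mulOf_cM02 (x y : Fin 4 → ℂ) :
    mulOf cM02 x y = ![0, 0, x 0 * y 0, x 1 * y 1] := by
  funext k
  fin_cases k <;> simp [mulOf, cM02, Fin.sum_univ_four]

theorem formOf_Δ {n : ℕ} (i j : Fin n) (x y : Fin n → ℂ) : formOf (Δ i j) x y = x i * y j := by
  unfold formOf Δ
  rw [Finset.sum_eq_single i]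
  · rw [Finset.sum_eq_single j]
    · simp
    · intro b _ hb
      simp [hb]
    · simp
  · intro b _ hb
    simp [hb]
  · simp

theorem formOf_single {n : ℕ} (N : Matrix (Fin n) (Fin n) ℂ) (i j : Fin n) :
    formOf N (Pi.single i 1) (Pi.single j 1) = N i j := by
  simp [formOf, Pi.single_apply]

/-- `H²(𝔑₀₂,ℂ)` has dimension 4, with basis `[Δ₁₂], [Δ₂₁], [Δ₃₁], [Δ₄₂]`. -/
theorem statement9 : HBasis cM02 ![Δ 0 1, Δ 1 0, Δ 2 0, Δ 3 1] := by
  refine ⟨?_, ?_⟩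
  · intro i x y z
    fin_cases i
    · change formOf (Δ 0 1) _ _ = formOf (Δ 0 1) _ _ + formOf (Δ 0 1) _ _
      simp [formOf_Δ, mulOf_cM02]
    · change formOf (Δ 1 0) _ _ = formOf (Δ 1 0) _ _ + formOf (Δ 1 0) _ _
      simp [formOf_Δ, mulOf_cM02]
    · change formOf (Δ 2 0) _ _ = formOf (Δ 2 0) _ _ + formOf (Δ 2 0) _ _
      simp [formOf_Δ, mulOf_cM02]
      ring
    · change formOf (Δ 3 1) _ _ = formOf (Δ 3 1) _ _ + formOf (Δ 3 1) _ _
      simp [formOf_Δ, mulOf_cM02]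
      ring
  · intro N hN
    have h3 : ∀ i, N i 2 = 0 := by
      intro i
      have h := hN (Pi.single i 1) (Pi.single 0 1) (Pi.single 0 1)
      have e : mulOf cM02 (Pi.single 0 1) (Pi.single 0 1) = Pi.single 2 1 := by
        rw [mulOf_cM02]; funext k; fin_cases k <;> simp
      rw [e, formOf_single] at h
      simpa using h
    have h4 : ∀ i, N i 3 = 0 := by
      intro i
      have h := hN (Pi.single i 1) (Pi.single 1 1) (Pi.single 1 1)
      have e : mulOf cM02 (Pi.single 1 1) (Pi.single 1 1) = Pi.single 3 1 := by
        rw [mulOf_cM02]; funext k; fin_cases k <;> simp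
      rw [e, formOf_single] at h
      simpa using h
    have h21 : N 2 1 = 0 := by
      have h := hN (Pi.single 0 1) (Pi.single 0 1) (Pi.single 1 1)
      simpa [mulOf_cM02, formOf, Fin.sum_univ_four] using h
    have h30 : N 3 0 = 0 := by
      have h := hN (Pi.single 1 1) (Pi.single 1 1) (Pi.single 0 1)
      simpa [mulOf_cM02, formOf, Fin.sum_univ_four] using h
    refine ⟨![N 0 1, N 1 0, N 2 0, N 3 1], ⟨![0, 0, N 0 0, N 1 1], ?_⟩, ?_⟩
    · intro x y
      simp [mulOf_cM02, formOf_Δ, Fin.sum_univ_four]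
      simp [formOf, Fin.sum_univ_four, h3, h4, h21, h30]
      ring
    · rintro a ⟨g, hg⟩
      have key : ∀ i j : Fin 4, formOf N (Pi.single i 1) (Pi.single j 1) =
          (a 0 * formOf (Δ 0 1) (Pi.single i 1) (Pi.single j 1)
            + a 1 * formOf (Δ 1 0) (Pi.single i 1) (Pi.single j 1)
            + a 2 * formOf (Δ 2 0) (Pi.single i 1) (Pi.single j 1)
            + a 3 * formOf (Δ 3 1) (Pi.single i 1) (Pi.single j 1))
          + ∑ l, mulOf cM02 (Pi.single i 1) (Pi.single j 1) l * g l := by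
        intro i j
        rw [hg, Fin.sum_univ_four]
        rfl
      simp only [formOf_single N, formOf_Δ] at key
      have k1 := key 0 1
      have k2 := key 1 0
      have k3 := key 2 0
      have k4 := key 3 1
      simp [mulOf_cM02, Fin.sum_univ_four] at k1 k2 k3 k4
      rw [k1, k2, k3, k4]
      funext k
      fin_cases k <;> rfl
end
end

section
/- Let 𝔑₀₇ be the 4-dimensional complex Leibniz algebra with basis e₁,e₂,e₃,e₄ and nonzero products of basis vectors e₁e₂ = e₃, e₂e₁ = e₄, e₂e₂ = −e₃. Then H²(𝔑₀₇,ℂ) has dimension 4, with basis given by the classes [Δ₁₁], [Δ₂₂], [Δ₃₂], [Δ₄₁]. -/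
noncomputable section

/-- The 4-dimensional Leibniz algebra `𝔑₀₇`: `e₁e₂ = e₃`, `e₂e₁ = e₄`, `e₂e₂ = -e₃`. -/
def cM07 : Fin 4 → Fin 4 → Fin 4 → ℂ := fun i j k =>
  (if i = 0 ∧ j = 1 ∧ k = 2 then 1 else 0) +
  (if i = 1 ∧ j = 0 ∧ k = 3 then 1 else 0) +
  (if i = 1 ∧ j = 1 ∧ k = 2 then -1 else 0)

/-- The multiplication in coordinates. -/
lemma mul07 (x y : Fin 4 → ℂ) :
    mulOf cM07 x y = ![0, 0, x 0 * y 1 - x 1 * y 1, x 1 * y 0] := by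
  funext k
  fin_cases k <;> simp [mulOf, cM07, Fin.sum_univ_four] <;> ring

/-- The forms `Δ i j` in coordinates. -/
lemma form_delta (i j : Fin 4) (x y : Fin 4 → ℂ) : formOf (Δ i j) x y = x i * y j := by
  simp [formOf, Δ, ite_and, Finset.sum_ite_eq']

/-- The value of a form on basis vectors. -/
lemma form_single (N : Matrix (Fin 4) (Fin 4) ℂ) (i j : Fin 4) :
    formOf N (Pi.single i 1) (Pi.single j 1) = N i j := by
  simp [formOf, Pi.single_apply]

/-- `H²(𝔑₀₇,ℂ)` has dimension 4, with basis `[Δ₁₁], [Δ₂₂], [Δ₃₂], [Δ₄₁]`. -/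
theorem statement10 : HBasis cM07 ![Δ 0 0, Δ 1 1, Δ 2 1, Δ 3 0] := by
  refine ⟨?_, ?_⟩
  · intro i x y z
    fin_cases i <;> simp [form_delta, mul07] <;> ring
  · intro N hN
    have H : ∀ i j k : Fin 4, _ := fun i j k =>
      hN (Pi.single i 1) (Pi.single j 1) (Pi.single k 1)
    have h1 := H 0 0 1
    have h2 := H 0 1 0
    have h3 := H 0 1 1
    have h4 := H 1 0 1
    have h5 := H 1 1 1
    have h6 := H 2 0 1
    have h7 := H 2 1 0
    have h8 := H 3 0 1
    have h9 := H 3 1 0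
    have h10 := H 1 1 0
    simp [mul07, formOf, Fin.sum_univ_four, Pi.single_apply] at h1 h2 h3 h4 h5 h6 h7 h8 h9 h10
    refine ⟨![N 0 0, N 1 1 + N 0 1, N 2 1, N 3 0], ⟨![0, 0, N 0 1, N 1 0], ?_⟩, ?_⟩
    · intro x y
      simp only [Fin.sum_univ_four]
      simp [form_delta, mul07]
      simp [formOf, Fin.sum_univ_four]
      grind
    · rintro a ⟨g, hg⟩
      have G : ∀ i j : Fin 4, _ := fun i j => hg (Pi.single i 1) (Pi.single j 1)
      have g1 := G 0 0
      have g2 := G 1 1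
      have g3 := G 2 1
      have g4 := G 3 0
      have g5 := G 0 1
      rw [form_single] at g1 g2 g3 g4 g5
      simp [form_delta, mul07, Fin.sum_univ_four, Pi.single_apply] at g1 g2 g3 g4 g5
      funext k
      fin_cases k <;> simp <;> grind
end
end

section
/- Let 𝔏₂ be the 4-dimensional complex Leibniz algebra with basis e₁,e₂,e₃,e₄ and nonzero products of basis vectors e₁e₂ = e₃, e₁e₃ = e₄, e₂e₁ = −e₃, e₃e₁ = −e₄. Then H²(𝔏₂,ℂ) has dimension 5, with basis given by the classes [Δ₁₁], [Δ₂₁], [Δ₂₂], [Δ₂₃−Δ₃₂], [Δ₁₄−Δ₄₁]; moreover every cocycle θ ∈ Z²(𝔏₂,ℂ) differs by a coboundary from a cocycle satisfying θ(x,yz) = θ(xy,z) + θ(y,xz) for all x,y,z. -/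
noncomputable section

/-- The 4-dimensional Leibniz algebra `𝔏₂`:
`e₁e₂ = e₃`, `e₁e₃ = e₄`, `e₂e₁ = -e₃`, `e₃e₁ = -e₄`. -/
def cL2 : Fin 4 → Fin 4 → Fin 4 → ℂ := fun i j k =>
  (if i = 0 ∧ j = 1 ∧ k = 2 then 1 else 0) +
  (if i = 0 ∧ j = 2 ∧ k = 3 then 1 else 0) +
  (if i = 1 ∧ j = 0 ∧ k = 2 then -1 else 0) +
  (if i = 2 ∧ j = 0 ∧ k = 3 then -1 else 0)

/-- Explicit multiplication in the algebra. -/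
lemma mul_cL2 (x y : Fin 4 → ℂ) :
    mulOf cL2 x y = ![0, 0, x 0 * y 1 - x 1 * y 0, x 0 * y 2 - x 2 * y 0] := by
  funext k
  revert k
  rw [Fin.forall_fin_succ, Fin.forall_fin_succ, Fin.forall_fin_succ, Fin.forall_fin_one]
  refine ⟨?_, ?_, ?_, ?_⟩ <;> simp [mulOf, cL2, Fin.sum_univ_four] <;> ring

lemma form_four (M : Matrix (Fin 4) (Fin 4) ℂ) (x y : Fin 4 → ℂ) :
    formOf M x y =
      x 0 * (M 0 0 * y 0 + M 0 1 * y 1 + M 0 2 * y 2 + M 0 3 * y 3) +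
      x 1 * (M 1 0 * y 0 + M 1 1 * y 1 + M 1 2 * y 2 + M 1 3 * y 3) +
      x 2 * (M 2 0 * y 0 + M 2 1 * y 1 + M 2 2 * y 2 + M 2 3 * y 3) +
      x 3 * (M 3 0 * y 0 + M 3 1 * y 1 + M 3 2 * y 2 + M 3 3 * y 3) := by
  simp only [formOf, Fin.sum_univ_four]
  ring

/-- The linear relations on the entries of a cocycle. -/
lemma cocycle_entries (N : Matrix (Fin 4) (Fin 4) ℂ) (h : IsCocycle cL2 N) :
    N 2 0 = -N 0 2 ∧ N 3 0 = -N 0 3 ∧ N 2 1 = -N 1 2 ∧ N 2 2 = 0 ∧ N 1 3 = 0 ∧ N 3 1 = 0 ∧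
    N 2 3 = 0 ∧ N 3 2 = 0 ∧ N 3 3 = 0 := by
  have h010 := h ![1, 0, 0, 0] ![0, 1, 0, 0] ![1, 0, 0, 0]
  have h012 := h ![1, 0, 0, 0] ![0, 1, 0, 0] ![0, 0, 1, 0]
  have h013 := h ![1, 0, 0, 0] ![0, 1, 0, 0] ![0, 0, 0, 1]
  have h020 := h ![1, 0, 0, 0] ![0, 0, 1, 0] ![1, 0, 0, 0]
  have h023 := h ![1, 0, 0, 0] ![0, 0, 1, 0] ![0, 0, 0, 1]
  have h101 := h ![0, 1, 0, 0] ![1, 0, 0, 0] ![0, 1, 0, 0]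
  have h102 := h ![0, 1, 0, 0] ![1, 0, 0, 0] ![0, 0, 1, 0]
  have h201 := h ![0, 0, 1, 0] ![1, 0, 0, 0] ![0, 1, 0, 0]
  have h202 := h ![0, 0, 1, 0] ![1, 0, 0, 0] ![0, 0, 1, 0]
  simp [form_four, mul_cL2] at h010 h012 h013 h020 h023 h101 h102 h201 h202
  grind

/-- Conversely, the relations make a cocycle which also satisfies the symmetric identity. -/
lemma cocycle_of_entries (N : Matrix (Fin 4) (Fin 4) ℂ)
    (h : N 2 0 = -N 0 2 ∧ N 3 0 = -N 0 3 ∧ N 2 1 = -N 1 2 ∧ N 2 2 = 0 ∧ N 1 3 = 0 ∧ N 3 1 = 0 ∧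
    N 2 3 = 0 ∧ N 3 2 = 0 ∧ N 3 3 = 0) :
    IsCocycle cL2 N ∧ ∀ x y z : Fin 4 → ℂ,
        formOf N x (mulOf cL2 y z) =
          formOf N (mulOf cL2 x y) z + formOf N y (mulOf cL2 x z) := by
  obtain ⟨h1, h2, h3, h4, h5, h6, h7, h8, h9⟩ := h
  constructor <;> intro x y z <;>
    simp [form_four, mul_cL2, h1, h2, h3, h4, h5, h6, h7, h8, h9] <;> ring

/-- `H²(𝔏₂,ℂ)` has dimension 5, with basis
`[Δ₁₁], [Δ₂₁], [Δ₂₂], [Δ₂₃-Δ₃₂], [Δ₁₄-Δ₄₁]`; moreover `H²(𝔏₂,ℂ) = H²_𝒮(𝔏₂,ℂ)`. -/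
theorem statement14 :
    HBasis cL2 ![Δ 0 0, Δ 1 0, Δ 1 1, Δ 1 2 - Δ 2 1, Δ 0 3 - Δ 3 0] ∧
    SymmReduce cL2 := by
  refine ⟨⟨?_, ?_⟩, ?_⟩
  · intro i
    match i with
    | 0 => exact (cocycle_of_entries (Δ 0 0) (by simp [Δ])).1
    | 1 => exact (cocycle_of_entries (Δ 1 0) (by simp [Δ])).1
    | 2 => exact (cocycle_of_entries (Δ 1 1) (by simp [Δ])).1
    | 3 => exact (cocycle_of_entries (Δ 1 2 - Δ 2 1) (by simp [Δ])).1
    | 4 => exact (cocycle_of_entries (Δ 0 3 - Δ 3 0) (by simp [Δ])).1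
  · intro N hN
    obtain ⟨h1, h2, h3, h4, h5, h6, h7, h8, h9⟩ := cocycle_entries N hN
    refine ⟨![N 0 0, N 1 0 + N 0 1, N 1 1, N 1 2, N 0 3], ⟨![0, 0, N 0 1, N 0 2], ?_⟩, ?_⟩
    · intro x y
      rw [Fin.sum_univ_five]
      simp [form_four, mul_cL2, h1, h2, h3, h4, h5, h6, h7, h8, h9,
        Fin.sum_univ_four, Δ]
      ring
    · rintro a ⟨g, hg⟩
      simp only [Fin.sum_univ_five] at hg
      have e00 := hg ![1, 0, 0, 0] ![1, 0, 0, 0]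
      have e01 := hg ![1, 0, 0, 0] ![0, 1, 0, 0]
      have e10 := hg ![0, 1, 0, 0] ![1, 0, 0, 0]
      have e11 := hg ![0, 1, 0, 0] ![0, 1, 0, 0]
      have e12 := hg ![0, 1, 0, 0] ![0, 0, 1, 0]
      have e03 := hg ![1, 0, 0, 0] ![0, 0, 0, 1]
      simp [form_four, mul_cL2, Fin.sum_univ_four, Δ]
        at e00 e01 e10 e11 e12 e03
      funext i
      match i with
      | 0 => simp [e00]
      | 1 => simp [e01, e10]
      | 2 => simp [e11]
      | 3 => simp [e12]
      | 4 => simp [e03]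
  · intro N hN
    have h := cocycle_entries N hN
    obtain ⟨hc, hs⟩ := cocycle_of_entries N h
    exact ⟨N, 0, hc, hs, by intro x y; simp⟩
end
end
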